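/- Let (A_n) be a sequence of complex polynomials satisfying the recursion A_n''·A_{n−1} − 2A_n'·A_{n−1}' + A_n·A_{n−1}'' = 0 for all n, and suppose A_n and A_{n−1} have no common roots and A_n and A_{n+1} have no common roots. Then every root of A_n is simple. -/

import Mathlib

open Polynomial

/-- If `P'' Q - 2 P' Q' + P Q'' = 0`, then a root of `P` that is not a root of `Q` is simple. -/
theorem rootMultiplicity_eq_one_of_bilinear {R : Type*} [CommRing R] [IsDomain R] [CharZero R]
    {P Q : R[X]} {ξ : R} (hP : P ≠ 0) (hPξ : P.eval ξ = 0) (hQξ : Q.eval ξ ≠ 0)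
    (h : derivative (derivative P) * Q - 2 * derivative P * derivative Q
      + P * derivative (derivative Q) = 0) :
    rootMultiplicity ξ P = 1 := by
  have hpos : 0 < rootMultiplicity ξ P := (rootMultiplicity_pos hP).2 hPξ
  by_contra hne
  obtain ⟨m, hm⟩ : ∃ m, rootMultiplicity ξ P = m + 2 := ⟨rootMultiplicity ξ P - 2, by omega⟩
  obtain ⟨S, hS, hdvd⟩ := exists_eq_pow_rootMultiplicity_mul_and_not_dvd P hP ξ
  rw [hm] at hS
  have hSξ : S.eval ξ ≠ 0 := fun h0 => hdvd (dvd_iff_isRoot.2 h0)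
  have hd1 : derivative P = (X - C ξ) ^ (m + 1) *
      (((m : R[X]) + 2) * S + (X - C ξ) * derivative S) := by
    rw [hS]
    simp [derivative_X_sub_C_pow, map_ofNat C 2]
    ring
  have hd2 : derivative (derivative P) = (X - C ξ) ^ m *
      (((m : R[X]) + 1) * (((m : R[X]) + 2) * S + (X - C ξ) * derivative S)
        + (X - C ξ) * derivative (((m : R[X]) + 2) * S + (X - C ξ) * derivative S)) := by
    rw [hd1, derivative_mul, derivative_X_sub_C_pow]
    simp
    ring
  have hfac : (X - C ξ) ^ m *
      ((((m : R[X]) + 1) * (((m : R[X]) + 2) * S + (X - C ξ) * derivative S)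
        + (X - C ξ) * derivative (((m : R[X]) + 2) * S + (X - C ξ) * derivative S)) * Q
      - 2 * (X - C ξ) * (((m : R[X]) + 2) * S + (X - C ξ) * derivative S) * derivative Q
      + (X - C ξ) ^ 2 * S * derivative (derivative Q)) = 0 := by
    rw [hd2, hd1, hS] at h
    rw [← h]
    ring
  have heval := congrArg (eval ξ)
    ((mul_eq_zero.1 hfac).resolve_left (pow_ne_zero m (X_sub_C_ne_zero ξ)))
  have hm1 : (m : R) + 1 ≠ 0 := by exact_mod_cast m.succ_ne_zero
  have hm2 : (m : R) + 2 ≠ 0 := by exact_mod_cast (m + 1).succ_ne_zero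
  simp [hm1, hm2, hSξ, hQξ] at heval

/-- If a sequence of polynomials satisfies the bilinear Adler–Moser recursion
A_{n+1}''A_n − 2A_{n+1}'A_n' + A_{n+1}A_n'' = 0 for all n, and A_{n+1} has no
common root with its neighbors A_n and A_{n+2}, then every root of A_{n+1}
is simple. -/
theorem roots_simple_of_recursion (A : ℕ → Polynomial ℂ)
    (hrec : ∀ m : ℕ,
      derivative (derivative (A (m + 1))) * A m
        - 2 * derivative (A (m + 1)) * derivative (A m)
        + A (m + 1) * derivative (derivative (A m)) = 0)
    (n : ℕ) (hA : A (n + 1) ≠ 0)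
    (h1 : ∀ ξ : ℂ, ¬((A (n + 1)).eval ξ = 0 ∧ (A n).eval ξ = 0))
    (h2 : ∀ ξ : ℂ, ¬((A (n + 1)).eval ξ = 0 ∧ (A (n + 2)).eval ξ = 0)) :
    ∀ ξ : ℂ, (A (n + 1)).eval ξ = 0 → rootMultiplicity ξ (A (n + 1)) = 1 := by
  intro ξ hξ
  exact rootMultiplicity_eq_one_of_bilinear hA hξ (fun hQ => h1 ξ ⟨hξ, hQ⟩) (hrec n)
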